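/- arXiv:1911.08801 — 3 statements merged into one kernel-verified Lean document; each statement's English description precedes it below -/
import Mathlib

section
/- For every natural number i, the i-th transport coefficient of the artificial scattering kernel satisfies lim_{ε→0⁺} p_{ε,i} / ε^i = Γ((1+i)/2) / √π, where Γ is the Gamma function; in particular p_{ε,i} = O(ε^i) as ε → 0⁺, and the transport coefficients satisfy the scaling condition required for the Fokker–Planck limit. -/
open MeasureTheory intervalIntegral Filter Topology Asymptotics

/-- The artificial scattering kernel
`s_ε(μ) = exp(-(1-μ)²/ε²) / (ε · ∫_0^{2/ε} exp(-t²) dt)`. -/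
noncomputable def asKernel (ε μ : ℝ) : ℝ :=
  Real.exp (-(1 - μ) ^ 2 / ε ^ 2) / (ε * ∫ t in (0 : ℝ)..(2 / ε), Real.exp (-t ^ 2))

/-- The `i`-th transport coefficient `p_{ε,i} = ∫_{-1}^{1} (1-μ)^i s_ε(μ) dμ`. -/
noncomputable def transportCoeff (ε : ℝ) (i : ℕ) : ℝ :=
  ∫ μ in (-1 : ℝ)..1, (1 - μ) ^ i * asKernel ε μ

lemma moment_tendsto (i : ℕ) :
    Tendsto (fun ε : ℝ => ∫ t in (0 : ℝ)..(2 / ε), t ^ i * Real.exp (-t ^ 2)) (𝓝[>] (0 : ℝ))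
      (𝓝 (1 / 2 * Real.Gamma ((1 + (i : ℝ)) / 2))) := by
  have hi : (-1 : ℝ) < (i : ℝ) := by
    have : (0 : ℝ) ≤ (i : ℝ) := Nat.cast_nonneg i
    linarith
  have h1 := integrableOn_rpow_mul_exp_neg_rpow hi (two_pos : (0 : ℝ) < 2)
  have h2 := integral_rpow_mul_exp_neg_rpow (two_pos : (0 : ℝ) < 2) hi
  simp only [Real.rpow_natCast, Real.rpow_two] at h1 h2
  rw [add_comm (1 : ℝ), ← h2]
  refine intervalIntegral_tendsto_integral_Ioi 0 h1 ?_
  change Tendsto (fun ε : ℝ => 2 / ε) _ _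
  simp only [div_eq_mul_inv]
  exact tendsto_inv_nhdsGT_zero.const_mul_atTop two_pos

lemma transportCoeff_div (i : ℕ) {ε : ℝ} (hε : 0 < ε) :
    transportCoeff ε i / ε ^ i =
      (∫ t in (0 : ℝ)..(2 / ε), t ^ i * Real.exp (-t ^ 2)) /
        ∫ t in (0 : ℝ)..(2 / ε), t ^ 0 * Real.exp (-t ^ 2) := by
  simp only [pow_zero, one_mul]
  unfold transportCoeff asKernel
  set D := ∫ t in (0 : ℝ)..(2 / ε), Real.exp (-t ^ 2)
  have hne := hε.ne'
  have h : ∀ μ : ℝ, (1 - μ) ^ i * (Real.exp (-(1 - μ) ^ 2 / ε ^ 2) / (ε * D)) =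
      (ε ^ i / (ε * D)) * (fun t : ℝ => t ^ i * Real.exp (-t ^ 2)) (1 / ε - μ / ε) := by
    intro μ
    have e1 : 1 / ε - μ / ε = (1 - μ) / ε := by ring
    simp only [e1, div_pow, neg_div]
    field_simp
  simp only [h]
  rw [intervalIntegral.integral_const_mul, 
    intervalIntegral.integral_comp_sub_div (fun t : ℝ => t ^ i * Real.exp (-t ^ 2)) hne]
  have e2 : 1 / ε - -1 / ε = 2 / ε := by ring
  rw [sub_self, e2, smul_eq_mul]
  field_simp

/-- For every `i : ℕ`, `lim_{ε→0⁺} p_{ε,i} / ε^i = Γ((1+i)/2) / √π`; in particular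
`p_{ε,i} = O(ε^i)` as `ε → 0⁺`. -/
theorem transport_coefficient_asymptotics (i : ℕ) :
    Tendsto (fun ε : ℝ => transportCoeff ε i / ε ^ i) (𝓝[>] (0 : ℝ))
        (𝓝 (Real.Gamma ((1 + (i : ℝ)) / 2) / Real.sqrt Real.pi)) ∧
      (fun ε : ℝ => transportCoeff ε i) =O[𝓝[>] (0 : ℝ)] fun ε : ℝ => ε ^ i := by
  have hlim : Tendsto (fun ε : ℝ => transportCoeff ε i / ε ^ i) (𝓝[>] (0 : ℝ))
      (𝓝 (Real.Gamma ((1 + (i : ℝ)) / 2) / Real.sqrt Real.pi)) := by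
    have h0 := moment_tendsto 0
    rw [Nat.cast_zero, add_zero, Real.Gamma_one_half_eq] at h0
    have hpi : Real.sqrt Real.pi ≠ 0 := (Real.sqrt_pos.mpr Real.pi_pos).ne'
    have h := (moment_tendsto i).div h0 (mul_ne_zero (by norm_num) hpi)
    rw [mul_div_mul_left _ _ (by norm_num : (1 / 2 : ℝ) ≠ 0)] at h
    refine h.congr' ?_
    filter_upwards [self_mem_nhdsWithin] with ε hε
    exact (transportCoeff_div i hε).symm
  refine ⟨hlim, isBigO_of_div_tendsto_nhds ?_ _ hlim⟩
  filter_upwards [self_mem_nhdsWithin] with ε hε h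
  exact absurd h (pow_pos hε i).ne'
end

section
/- The symmetrized stencil matrix of the implicit second-order upwind scheme is positive definite: for every N ≥ 1, the real symmetric N×N pentadiagonal Toeplitz matrix S with diagonal entries S_{j,j} = 3/2, first off-diagonal entries S_{j,j−1} = S_{j−1,j} = −1, second off-diagonal entries S_{j,j−2} = S_{j−2,j} = 1/4, and all other entries zero, is positive definite; that is, ψᵀSψ > 0 for every nonzero ψ ∈ ℝᴺ (equivalently, all eigenvalues of S are positive). -/
open Matrix

/-- The symmetrized stencil matrix of the implicit second-order upwind scheme: the symmetric
pentadiagonal Toeplitz matrix with diagonal `3/2`, first off-diagonals `−1`, and second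
off-diagonals `1/4`. -/
noncomputable def upwindSymmetrized (N : ℕ) : Matrix (Fin N) (Fin N) ℝ :=
  Matrix.of fun i j =>
    if (i : ℕ) = (j : ℕ) then 3 / 2
    else if (i : ℕ) + 1 = (j : ℕ) ∨ (j : ℕ) + 1 = (i : ℕ) then -1
    else if (i : ℕ) + 2 = (j : ℕ) ∨ (j : ℕ) + 2 = (i : ℕ) then 1 / 4
    else 0

/-- Stencil coefficients on natural-number indices. -/
noncomputable def stencilCoeff (i j : ℕ) : ℝ :=
  if i = j then 3 / 2
  else if i + 1 = j ∨ j + 1 = i then -1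
  else if i + 2 = j ∨ j + 2 = i then 1 / 4
  else 0

lemma stencilCoeff_succ (i j : ℕ) : stencilCoeff (i + 1) (j + 1) = stencilCoeff i j := by
  unfold stencilCoeff
  grind

lemma stencilCoeff_comm (i j : ℕ) : stencilCoeff i j = stencilCoeff j i := by
  unfold stencilCoeff
  grind

lemma stencil_row (N : ℕ) (f : ℕ → ℝ) (hf : ∀ i, N + 1 ≤ i → f i = 0) :
    ∑ j ∈ Finset.range N, stencilCoeff 0 (j + 1) * f (j + 1) = - f 1 + 1 / 4 * f 2 := by
  match N, hf with
  | 0, hf => simp [hf 1, hf 2]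
  | 1, hf => simp [hf 2, stencilCoeff]
  | n + 2, hf =>
    rw [Finset.sum_range_succ', Finset.sum_range_succ', Finset.sum_eq_zero]
    · simp [stencilCoeff]; ring
    · intro j _
      simp [stencilCoeff]

/-- The quadratic form of the stencil. -/
noncomputable def stencilForm (N : ℕ) (f : ℕ → ℝ) : ℝ :=
  ∑ i ∈ Finset.range N, ∑ j ∈ Finset.range N, f i * (stencilCoeff i j * f j)

lemma stencilForm_succ (N : ℕ) (f : ℕ → ℝ) (hf : ∀ i, N + 1 ≤ i → f i = 0) :
    stencilForm (N + 1) f = 3 / 2 * f 0 ^ 2 - 2 * f 0 * f 1 + 1 / 2 * f 0 * f 2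
      + stencilForm N (fun i => f (i + 1)) := by
  have h := stencil_row N f hf
  have h1 : ∑ j ∈ Finset.range N, f 0 * (stencilCoeff 0 (j + 1) * f (j + 1))
      = f 0 * (- f 1 + 1 / 4 * f 2) := by rw [← Finset.mul_sum, h]
  have h2 : ∑ j ∈ Finset.range N, f (j + 1) * (stencilCoeff (j + 1) 0 * f 0)
      = f 0 * (- f 1 + 1 / 4 * f 2) := by
    rw [← h1]
    refine Finset.sum_congr rfl fun j _ => ?_
    rw [stencilCoeff_comm]; ring
  have h0 : stencilCoeff 0 0 = 3 / 2 := by simp [stencilCoeff]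
  unfold stencilForm
  rw [Finset.sum_range_succ']
  simp only [Finset.sum_range_succ' _ N, Finset.sum_add_distrib, stencilCoeff_succ, h1, h2, h0]
  ring

/-- Lower bound by the two leftmost squared second differences, together with definiteness. -/
lemma stencilForm_bound (N : ℕ) : ∀ f : ℕ → ℝ, (∀ i, N ≤ i → f i = 0) →
    f 0 ^ 2 + (f 1 - 2 * f 0) ^ 2 ≤ 4 * stencilForm N f ∧
    (stencilForm N f ≤ 0 → ∀ i, f i = 0) := by
  induction N with
  | zero =>
    intro f hf
    have h : ∀ i, f i = 0 := fun i => hf i (Nat.zero_le i)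
    simp [stencilForm, h]
  | succ N ih =>
    intro f hf
    obtain ⟨ih1, ih2⟩ := ih (fun i => f (i + 1)) (fun i hi => hf _ (by omega))
    have hs := stencilForm_succ N f hf
    simp only [zero_add, Nat.reduceAdd] at ih1
    have hb : f 0 ^ 2 + (f 1 - 2 * f 0) ^ 2 ≤ 4 * stencilForm (N + 1) f := by
      nlinarith [sq_nonneg (f 2 - 2 * f 1 + f 0)]
    refine ⟨hb, fun hle => ?_⟩
    have h0 : f 0 = 0 := by
      have : f 0 ^ 2 ≤ 0 := by nlinarith [sq_nonneg (f 1 - 2 * f 0)]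
      exact pow_eq_zero_iff two_ne_zero |>.1 (le_antisymm this (sq_nonneg _))
    have h := ih2 (by rw [hs, h0] at hle; linarith)
    intro i
    cases i with
    | zero => exact h0
    | succ i => exact h i

/-- The symmetrized stencil matrix of the implicit second-order upwind scheme is positive
definite: `ψᵀSψ > 0` for every nonzero `ψ ∈ ℝᴺ`, for every `N ≥ 1`. -/
theorem upwindSymmetrized_posDef (N : ℕ) (hN : 1 ≤ N)
    (ψ : Fin N → ℝ) (hψ : ψ ≠ 0) :
    0 < ψ ⬝ᵥ (upwindSymmetrized N *ᵥ ψ) := by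
  let f : ℕ → ℝ := fun i => if h : i < N then ψ ⟨i, h⟩ else 0
  have hfψ : ∀ i : Fin N, f i = ψ i := fun i => by simp [f]
  have hf : ∀ i, N ≤ i → f i = 0 := fun i hi => by simp [f, hi]
  have he : ψ ⬝ᵥ (upwindSymmetrized N *ᵥ ψ) = stencilForm N f := by
    simp only [stencilForm, Finset.sum_range, hfψ, dotProduct, mulVec, Finset.mul_sum]
    rfl
  rw [he]
  by_contra hneg
  have h := (stencilForm_bound N f hf).2 (not_lt.1 hneg)
  exact hψ (funext fun i => by rw [← hfψ, h]; rfl)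
end

section
/- L² stability of the implicit second-order upwind scheme: let N ≥ 1 and λ ≥ 0, and let B be the N×N lower triangular Toeplitz matrix with diagonal entries 3/2, first subdiagonal entries −2, second subdiagonal entries 1/2, and all other entries zero (this is the flux-difference matrix of the numerical flux g_{j+1/2} = (3/2)ψ_j − (1/2)ψ_{j−1} with zero inflow boundary values ψ_0 = ψ_{−1} = 0). If ψ, φ ∈ ℝᴺ satisfy the implicit update ψ + λ·Bψ = φ (i.e., ψ_j + λ[(3/2)ψ_j − 2ψ_{j−1} + (1/2)ψ_{j−2}] = φ_j for all j, with ψ_0 = ψ_{−1} = 0), then Σ_{j=1}^{N} ψ_j² ≤ Σ_{j=1}^{N} φ_j²; i.e., the scheme dissipates the L² entropy η(ψ) = ψ²/2. -/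
open Matrix

/-- The flux-difference matrix of the implicit second-order upwind scheme: the lower triangular
Toeplitz matrix with diagonal `3/2`, first subdiagonal `−2`, second subdiagonal `1/2`
(zero inflow boundary data `ψ₀ = ψ₋₁ = 0`). -/
noncomputable def upwindFluxMatrix (N : ℕ) : Matrix (Fin N) (Fin N) ℝ :=
  Matrix.of fun i j =>
    if (i : ℕ) = (j : ℕ) then 3 / 2
    else if (j : ℕ) + 1 = (i : ℕ) then -2
    else if (j : ℕ) + 2 = (i : ℕ) then 1 / 2
    else 0

/-- Zero extension of `ψ`, shifted by two. -/
noncomputable def upwindExt {N : ℕ} (ψ : Fin N → ℝ) (k : ℕ) : ℝ :=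
  if h : 2 ≤ k ∧ k - 2 < N then ψ ⟨k - 2, h.2⟩ else 0

lemma upwindExt_val {N : ℕ} (ψ : Fin N → ℝ) (j : Fin N) : upwindExt ψ (j + 2) = ψ j := by
  simp [upwindExt]

lemma upwindExt_sum {N : ℕ} (ψ : Fin N → ℝ) (i : Fin N) (s : ℕ) (hs : s ≤ 2) (c : ℝ) :
    ∑ j : Fin N, (if (j : ℕ) + s = (i : ℕ) then c * ψ j else 0)
      = c * upwindExt ψ ((i : ℕ) + 2 - s) := by
  by_cases hsi : s ≤ (i : ℕ)
  · have hlt : (i : ℕ) - s < N := by omega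
    rw [Finset.sum_eq_single (⟨(i : ℕ) - s, hlt⟩ : Fin N)]
    · have e : (i : ℕ) + 2 - s = ((⟨(i : ℕ) - s, hlt⟩ : Fin N) : ℕ) + 2 := by
        simp only
        omega
      rw [e, upwindExt_val, if_pos]
      simp only
      omega
    · intro b _ hb
      rw [if_neg]
      intro hh
      apply hb
      ext
      simp only
      omega
    · simp
  · rw [Finset.sum_eq_zero]
    · have : ¬ (2 ≤ (i : ℕ) + 2 - s ∧ (i : ℕ) + 2 - s - 2 < N) := by omega
      simp [upwindExt, this]
    · intro b _
      rw [if_neg]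
      omega

lemma upwind_mulVec {N : ℕ} (ψ : Fin N → ℝ) (i : Fin N) :
    (upwindFluxMatrix N *ᵥ ψ) i = 3 / 2 * upwindExt ψ (i + 2) + (-2) * upwindExt ψ (i + 1)
      + 1 / 2 * upwindExt ψ i := by
  have h0 := upwindExt_sum ψ i 0 (by omega) (3 / 2)
  have h1 := upwindExt_sum ψ i 1 (by omega) (-2)
  have h2 := upwindExt_sum ψ i 2 (by omega) (1 / 2)
  have e0 : (i : ℕ) + 2 - 0 = i + 2 := by omega
  have e1 : (i : ℕ) + 2 - 1 = i + 1 := by omega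
  have e2 : (i : ℕ) + 2 - 2 = i := by omega
  rw [e0] at h0
  rw [e1] at h1
  rw [e2] at h2
  rw [← h0, ← h1, ← h2, ← Finset.sum_add_distrib, ← Finset.sum_add_distrib]
  simp only [Matrix.mulVec, dotProduct, upwindFluxMatrix, Matrix.of_apply]
  refine Finset.sum_congr rfl fun j _ => ?_
  split_ifs <;> first | omega | ring

lemma upwind_energy (f : ℕ → ℝ) (h0 : f 0 = 0) (h1 : f 1 = 0) (n : ℕ) :
    5 / 4 * f (n + 1) ^ 2 - f (n + 1) * f n + 1 / 4 * f n ^ 2 ≤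
    ∑ k ∈ Finset.range n,
      f (k + 2) * (3 / 2 * f (k + 2) + (-2) * f (k + 1) + 1 / 2 * f k) := by
  induction n with
  | zero => simp [h0, h1]
  | succ n ih =>
    rw [Finset.sum_range_succ]
    nlinarith [sq_nonneg (f (n + 2) - 2 * f (n + 1) + f n)]

lemma upwind_nonneg {N : ℕ} (ψ : Fin N → ℝ) :
    0 ≤ ∑ j, ψ j * (upwindFluxMatrix N *ᵥ ψ) j := by
  have h := upwind_energy (upwindExt ψ) (by simp [upwindExt]) (by simp [upwindExt]) N
  rw [← Fin.sum_univ_eq_sum_range (fun k => upwindExt ψ (k + 2) * (3 / 2 * upwindExt ψ (k + 2)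
    + (-2) * upwindExt ψ (k + 1) + 1 / 2 * upwindExt ψ k))] at h
  simp only [upwindExt_val] at h
  simp only [upwind_mulVec, upwindExt_val]
  refine le_trans ?_ h
  nlinarith [sq_nonneg (upwindExt ψ (N + 1)),
    sq_nonneg (2 * upwindExt ψ (N + 1) - upwindExt ψ N)]

/-- L² stability of the implicit second-order upwind scheme: if `ψ + λ·Bψ = φ` with `λ ≥ 0`
and `B` the upwind flux-difference matrix, then `Σ_j ψ_j² ≤ Σ_j φ_j²`, i.e. the scheme
dissipates the L² entropy `η(ψ) = ψ²/2`. -/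
theorem upwind_implicit_l2_stable (N : ℕ) (hN : 1 ≤ N)
    (lam : ℝ) (hlam : 0 ≤ lam)
    (ψ φ : Fin N → ℝ) (h : ψ + lam • (upwindFluxMatrix N *ᵥ ψ) = φ) :
    ∑ j, ψ j ^ 2 ≤ ∑ j, φ j ^ 2 := by
  subst h
  have hB := mul_nonneg hlam (upwind_nonneg ψ)
  have key : ∑ j, (ψ j ^ 2 + 2 * (lam * (ψ j * (upwindFluxMatrix N *ᵥ ψ) j))) ≤
      ∑ j, (ψ + lam • (upwindFluxMatrix N *ᵥ ψ)) j ^ 2 := by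
    refine Finset.sum_le_sum fun j _ => ?_
    simp only [Pi.add_apply, Pi.smul_apply, smul_eq_mul]
    nlinarith [sq_nonneg (lam * (upwindFluxMatrix N *ᵥ ψ) j)]
  rw [Finset.sum_add_distrib, ← Finset.mul_sum, ← Finset.mul_sum] at key
  linarith
end
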